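/- Let n ≥ 1 and a ≥ 1/2 with n + 2a > 2, and let λ₀ ∈ ℝ. Suppose v is C² on {x ∈ ℝ^{n+1} : |x| > R, x_{n+1} ≠ 0} ∩ C¹ up to {x_{n+1} = 0}, satisfies the asymptotic expansion: there exist constants a₀ > 0, a₁, …, a_{n+1} ∈ ℝ, C > 0, R₀ > 0 such that for |x| ≥ R₀, |v(x) − a₀/|x|^{n+2a−2} − Σᵢ aᵢxᵢ/|x|^{n+2a}| ≤ C/|x|^{n+2a}, |∂ᵢv(x) + (n+2a−2)a₀xᵢ/|x|^{n+2a}| ≤ C/|x|^{n+2a}, and |∂_{ij}v(x)| ≤ C/|x|^{n+2a}; suppose moreover ∂_{n+1}v(x',0) = 0, and that w(x) := v(x) − v(x^{λ₀}) satisfies Δw + ((2a−1)/x_{n+1})∂_{n+1}w ≤ 0 and w(x) > 0 for all x ∈ Σ_{λ₀} with |x| > R and x_{n+1} ≠ 0. Then there exist ε > 0 and S > 0 such that: (i) ∂v/∂x₁ < 0 at every point x with |x₁ − λ₀| < ε and |x| > S; and (ii) there exists δ > 0 such that for every λ with |λ − λ₀| < δ and every x ∈ Σ_λ with x₁ ≤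 λ₀ − ε/2 and |x| > S, one has v(x) > v(x^λ). -/

import Mathlib

/-- First partial derivative in the `i`-th coordinate direction. -/
noncomputable def pd {m : ℕ} (f : EuclideanSpace ℝ (Fin m) → ℝ) (i : Fin m)
    (x : EuclideanSpace ℝ (Fin m)) : ℝ :=
  fderiv ℝ f x (EuclideanSpace.single i 1)

/-- Second partial derivative in the coordinate directions `i`, `j`. -/
noncomputable def pd2 {m : ℕ} (f : EuclideanSpace ℝ (Fin m) → ℝ) (i j : Fin m)
    (x : EuclideanSpace ℝ (Fin m)) : ℝ :=
  pd (fun z => pd f j z) i x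

/-- The reflection `x^λ = (2λ - x₁, x₂, …, x_{n+1})` across the hyperplane `{x₁ = λ}`. -/
noncomputable def reflPt (n : ℕ) (lam : ℝ) (x : EuclideanSpace ℝ (Fin (n + 1))) :
    EuclideanSpace ℝ (Fin (n + 1)) :=
  WithLp.toLp 2 (Function.update x 0 (2 * lam - x 0))

theorem sdt {g g1 : ℝ → ℝ} {g2 : ℝ} (h1 : ∀ᶠ t in nhds (0:ℝ), HasDerivAt g (g1 t) t)
    (h2 : HasDerivAt g1 g2 0) (hm : IsLocalMin g 0) : g1 0 = 0 ∧ 0 ≤ g2 := by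
  have e0 : g1 0 = 0 := hm.hasDerivAt_eq_zero h1.self_of_nhds
  refine ⟨e0, ?_⟩
  by_contra hneg
  push Not at hneg
  have hd : deriv g =ᶠ[nhds 0] g1 := h1.mono fun t ht => ht.deriv
  have hdd : deriv (deriv g) 0 = g2 := by rw [hd.deriv_eq, h2.deriv]
  have hM : IsLocalMax g 0 := isLocalMax_of_deriv_deriv_neg (by rw [hdd]; exact hneg)
    (by rw [hd.self_of_nhds, e0]) h1.self_of_nhds.continuousAt
  have hc : g =ᶠ[nhds 0] fun _ => g 0 := by
    filter_upwards [hm, hM] with t a b using le_antisymm b a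
  have hd0 : deriv g =ᶠ[nhds 0] fun _ => 0 := by
    filter_upwards [hc.eventuallyEq_nhds] with t ht
    rw [ht.deriv_eq]; simp
  have := hd0.deriv_eq
  rw [hdd] at this
  simp at this
  linarith

theorem line_norm {m : ℕ} (x q : EuclideanSpace ℝ (Fin m)) (i : Fin m) (t : ℝ) :
    ‖x + t • EuclideanSpace.single i (1:ℝ) - q‖ ^ 2 = ‖x - q‖ ^ 2 + 2 * t * (x i - q i) + t ^ 2 := by
  rw [show x + t • EuclideanSpace.single i (1:ℝ) - q = (x - q) + t • EuclideanSpace.single i (1:ℝ) by abel,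
    norm_add_sq_real, inner_smul_right, norm_smul]
  simp [EuclideanSpace.inner_single_right]
  ring

theorem line_deriv {m : ℕ} {f : EuclideanSpace ℝ (Fin m) → ℝ} (x : EuclideanSpace ℝ (Fin m))
    (i : Fin m) (t : ℝ) (h : DifferentiableAt ℝ f (x + t • EuclideanSpace.single i (1:ℝ))) :
    HasDerivAt (fun t : ℝ => f (x + t • EuclideanSpace.single i (1:ℝ)))
      (pd f i (x + t • EuclideanSpace.single i (1:ℝ))) t := by
  have h1 : HasDerivAt (fun t : ℝ => x + t • EuclideanSpace.single i (1:ℝ))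
      (EuclideanSpace.single i (1:ℝ)) t := by
    simpa using ((hasDerivAt_id t).smul_const (EuclideanSpace.single i (1:ℝ))).const_add x
  exact h.hasFDerivAt.comp_hasDerivAt t h1

theorem line_cont {m : ℕ} (x : EuclideanSpace ℝ (Fin m)) (i : Fin m) :
    Continuous (fun t : ℝ => x + t • EuclideanSpace.single i (1:ℝ)) := by fun_prop

/-- the barrier -/
noncomputable def bar (n : ℕ) (lam : ℝ) (q : EuclideanSpace ℝ (Fin (n + 1))) (b p d : ℝ)
    (x : EuclideanSpace ℝ (Fin (n + 1))) : ℝ :=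
  (lam - x 0) * ((‖x - q‖ ^ 2 - b) ^ (-p) - d)

/-- first derivative of the barrier along the line -/
noncomputable def bar1 (e l s u b p d t : ℝ) : ℝ :=
  -e * ((s + 2 * t * u + t ^ 2 - b) ^ (-p) - d) +
    (l - t * e) * ((-p) * (s + 2 * t * u + t ^ 2 - b) ^ (-p - 1) * (2 * u + 2 * t))

theorem bar_deriv (e l s u b p d t : ℝ) (h : b < s + 2 * t * u + t ^ 2) :
    HasDerivAt (fun t : ℝ => (l - t * e) * ((s + 2 * t * u + t ^ 2 - b) ^ (-p) - d))
      (bar1 e l s u b p d t) t := by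
  have h0 : HasDerivAt (fun t : ℝ => s + 2 * t * u + t ^ 2 - b) (2 * u + 2 * t) t := by
    have := (((((hasDerivAt_id t).const_mul 2).mul_const u).const_add s).add
      ((hasDerivAt_id t).pow 2)).sub_const b
    refine this.congr_deriv ?_
    simp
  have h1 := (h0.rpow_const (p := -p) (Or.inl (by linarith))).sub_const d
  have h2 : HasDerivAt (fun t : ℝ => l - t * e) (-e) t := by
    simpa using ((hasDerivAt_id t).mul_const e).const_sub l
  refine (h2.mul h1).congr_deriv ?_
  unfold bar1; ring

theorem bar1_deriv (e l s u b p d : ℝ) (h : b < s) :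
    HasDerivAt (bar1 e l s u b p d)
      (2 * (-e) * ((-p) * (s - b) ^ (-p - 1) * (2 * u)) +
        l * (p * (p + 1) * (s - b) ^ (-p - 2) * (4 * u ^ 2) + (-p) * (s - b) ^ (-p - 1) * 2)) 0 := by
  have h0 : HasDerivAt (fun t : ℝ => s + 2 * t * u + t ^ 2 - b) (2 * u) 0 := by
    have := (((((hasDerivAt_id (0:ℝ)).const_mul 2).mul_const u).const_add s).add
      ((hasDerivAt_id (0:ℝ)).pow 2)).sub_const b
    refine this.congr_deriv ?_
    simp
  have hne : s + 2 * 0 * u + 0 ^ 2 - b ≠ 0 := by simp; linarith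
  have h1 := (h0.rpow_const (p := -p) (Or.inl hne)).sub_const d
  have h1' := (h0.rpow_const (p := -p - 1) (Or.inl hne))
  have h2 : HasDerivAt (fun t : ℝ => l - t * e) (-e) 0 := by
    simpa using ((hasDerivAt_id (0:ℝ)).mul_const e).const_sub l
  have h3 : HasDerivAt (fun t : ℝ => 2 * u + 2 * t) 2 0 := by
    simpa using ((hasDerivAt_id (0:ℝ)).const_mul 2).const_add (2 * u)
  have := (h1.const_mul (-e)).add (h2.mul ((h1'.const_mul (-p)).mul h3))
  refine this.congr_deriv ?_
  simp only [show -p - 1 - 1 = -p - 2 by ring, Pi.mul_apply]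
  simp
  ring

theorem bar_line (n : ℕ) (lam : ℝ) (q : EuclideanSpace ℝ (Fin (n + 1))) (b p d : ℝ)
    (x : EuclideanSpace ℝ (Fin (n + 1))) (i : Fin (n+1)) (t : ℝ) :
    bar n lam q b p d (x + t • EuclideanSpace.single i (1:ℝ)) =
      ((lam - x 0) - t * (if i = 0 then 1 else 0)) *
        ((‖x - q‖ ^ 2 + 2 * t * (x i - q i) + t ^ 2 - b) ^ (-p) - d) := by
  unfold bar
  rw [line_norm]
  congr 1
  by_cases h : i = 0
  · subst h; simp; ring
  · have : (0 : Fin (n+1)) ≠ i := fun h' => h h'.symm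
    simp [h, this]

theorem interior_min (n : ℕ) (hn : 1 ≤ n) (a : ℝ) (ha : (1 : ℝ) / 2 ≤ a) (lam : ℝ)
    (w : EuclideanSpace ℝ (Fin (n + 1)) → ℝ) (p : ℝ) (hp : 2 * p = n + 2 * a)
    (x q : EuclideanSpace ℝ (Fin (n + 1)))
    (hd1 : ∀ᶠ z in nhds x, DifferentiableAt ℝ w z)
    (hd2 : ∀ i, DifferentiableAt ℝ (fun z => pd w i z) x)
    (hL : (∑ i, pd2 w i i x) + ((2 * a - 1) / x (Fin.last n)) * pd w (Fin.last n) x ≤ 0)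
    (hx0 : x 0 < lam) (hq0 : q 0 ≤ lam) (hxt : x (Fin.last n) ≠ 0)
    (hqt : 0 < q (Fin.last n) / x (Fin.last n))
    (b d η : ℝ) (hb : 0 < b) (hbs : b < ‖x - q‖ ^ 2) (hη : 0 < η)
    (hmin : IsLocalMin (fun z => w z - η * bar n lam q b p d z) x) : False := by
  set s := ‖x - q‖ ^ 2 with hs
  set l := lam - x 0 with hl
  have key : ∀ i : Fin (n+1), pd w i x - η * bar1 (if i = 0 then 1 else 0) l s (x i - q i) b p d 0 = 0 ∧
      0 ≤ pd2 w i i x - η * (2 * (-(if i = 0 then 1 else 0)) * ((-p) * (s - b) ^ (-p - 1) * (2 * (x i - q i))) +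
        l * (p * (p + 1) * (s - b) ^ (-p - 2) * (4 * (x i - q i) ^ 2) + (-p) * (s - b) ^ (-p - 1) * 2)) := by
    intro i
    have tl : Filter.Tendsto (fun t : ℝ => x + t • EuclideanSpace.single i (1:ℝ)) (nhds 0) (nhds x) := by
      simpa using (line_cont x i).tendsto 0
    have h := sdt (g := fun t : ℝ => w (x + t • EuclideanSpace.single i (1:ℝ)) -
        η * bar n lam q b p d (x + t • EuclideanSpace.single i (1:ℝ)))
      (g1 := fun t => pd w i (x + t • EuclideanSpace.single i (1:ℝ)) -
        η * bar1 (if i = 0 then 1 else 0) l s (x i - q i) b p d t)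
      (g2 := pd2 w i i x - η * (2 * (-(if i = 0 then 1 else 0)) * ((-p) * (s - b) ^ (-p - 1) * (2 * (x i - q i))) +
        l * (p * (p + 1) * (s - b) ^ (-p - 2) * (4 * (x i - q i) ^ 2) + (-p) * (s - b) ^ (-p - 1) * 2)))
      ?_ ?_ ?_
    · simpa using h
    · have hev : ∀ᶠ t in nhds (0:ℝ), b < s + 2 * t * (x i - q i) + t ^ 2 := by
        have : Continuous (fun t : ℝ => s + 2 * t * (x i - q i) + t ^ 2) := by fun_prop
        exact this.continuousAt.eventually (lt_mem_nhds (by simpa using hbs))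
      filter_upwards [tl.eventually hd1, hev] with t h1 h2
      simp only [bar_line]
      exact (line_deriv x i t h1).sub ((bar_deriv _ _ _ _ _ _ _ t h2).const_mul η)
    · have h2 := line_deriv (f := fun z => pd w i z) x i 0 (by simpa using hd2 i)
      have h2' : HasDerivAt (fun t : ℝ => pd w i (x + t • EuclideanSpace.single i (1:ℝ))) (pd2 w i i x) 0 := by
        refine h2.congr_deriv ?_
        simp [pd2]
      exact h2'.sub ((bar1_deriv _ _ _ _ _ _ _ hbs).const_mul η)
    · have := tl.eventually hmin
      unfold IsLocalMin IsMinFilter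
      simpa using this
  have hlp : 0 < l := by rw [hl]; linarith
  have hp0 : 0 < p := by
    have : (1:ℝ) ≤ n := by exact_mod_cast hn
    linarith
  set G := (s - b) ^ (-p - 2) with hG
  have hGp : 0 < G := Real.rpow_pos_of_pos (by linarith) _
  have hG1 : (s - b) ^ (-p - 1) = (s - b) * G := by
    rw [hG, show -p - 1 = 1 + (-p - 2) by ring, Real.rpow_add (by linarith), Real.rpow_one]
  rw [hG1] at key
  have hlast : Fin.last n ≠ 0 := by
    intro h; have := congrArg Fin.val h; simp at this; omega
  have hsum : ∑ i, (x i - q i) ^ 2 = s := by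
    rw [hs, EuclideanSpace.norm_sq_eq]; simp
  have h2 : η * (-4 * ((-p) * ((s - b) * G) * (x 0 - q 0)) +
        l * (p * (p + 1) * G * (4 * s) + (n + 1) * ((-p) * ((s - b) * G) * 2))) ≤ ∑ i, pd2 w i i x := by
    have := Finset.sum_le_sum fun i (_ : i ∈ Finset.univ) => sub_nonneg.1 (key i).2
    refine le_trans (le_of_eq ?_) this
    rw [← Finset.mul_sum, Finset.sum_add_distrib, ← Finset.mul_sum, Finset.sum_add_distrib]
    congr 2
    · simp [ite_mul, mul_ite]; ring
    · congr 2
      · rw [← hsum, Finset.mul_sum, Finset.mul_sum]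
      · simp
  have h1 : pd w (Fin.last n) x = η * (l * ((-p) * ((s-b) * G) * (2 * (x (Fin.last n) - q (Fin.last n))))) := by
    have := (key (Fin.last n)).1
    simp only [hlast, if_false, bar1] at this
    simp at this
    rw [hG1] at this
    linarith
  rw [h1] at hL
  have h3 : ((2 * a - 1) / x (Fin.last n)) * (η * (l * ((-p) * ((s-b) * G) * (2 * (x (Fin.last n) - q (Fin.last n)))))) 
     = η * (l * ((-p) * ((s-b) * G) * 2)) * (2 * a - 1) * (1 - q (Fin.last n) / x (Fin.last n)) := by
    field_simp
  rw [h3] at hL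
  set r := q (Fin.last n) / x (Fin.last n)
  have hK : 0 < p * ((s - b) * G) := by
    have : 0 < s - b := by linarith
    positivity
  set K := p * ((s - b) * G) with hKd
  have e1 : 0 ≤ η * K * (2 * a - 1) * l * r := by
    have : 0 ≤ 2 * a - 1 := by linarith
    positivity
  have e2 : 0 ≤ η * K * (lam - q 0) := by
    have : 0 ≤ lam - q 0 := by linarith
    positivity
  have e3 : 0 < η * l * p * G * (2 * p + 2) * b := by positivity
  have hx : x 0 = lam - l := by rw [hl]; ring
  have ha2 : 2 * a = 2 * p - n := by linarith
  have : η * (-4 * ((-p) * ((s - b) * G) * (x 0 - q 0)) +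
        l * (p * (p + 1) * G * (4 * s) + (n + 1) * ((-p) * ((s - b) * G) * 2))) + η * (l * ((-p) * ((s-b) * G) * 2)) * (2 * a - 1) * (1 - r)
     = 4 * (η * K * (lam - q 0)) + 2 * (η * K * (2 * a - 1) * l * r) + 2 * (η * l * p * G * (2 * p + 2) * b) := by
    rw [hx, hKd, ha2]; ring
  linarith

/-- working hypotheses on the difference function -/
structure WH (n : ℕ) (a lam R : ℝ) (w : EuclideanSpace ℝ (Fin (n + 1)) → ℝ) : Prop where
  d1 : ∀ x, R < ‖x‖ → DifferentiableAt ℝ w x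
  d2 : ∀ x, R < ‖x‖ → x (Fin.last n) ≠ 0 → ∀ i, DifferentiableAt ℝ (fun z => pd w i z) x
  sup : ∀ x, x 0 < lam → R < ‖x‖ → x (Fin.last n) ≠ 0 →
    (∑ i, pd2 w i i x) + ((2 * a - 1) / x (Fin.last n)) * pd w (Fin.last n) x ≤ 0
  neu : ∀ x, R < ‖x‖ → x (Fin.last n) = 0 → pd w (Fin.last n) x = 0
  pos : ∀ x, x 0 < lam → R < ‖x‖ → x (Fin.last n) ≠ 0 → 0 < w x
  nonneg : ∀ x, x 0 ≤ lam → R < ‖x‖ → 0 ≤ w x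

theorem one_sided {g : ℝ → ℝ} {g' : ℝ} (h : HasDerivAt g g' 0)
    (hm : ∀ᶠ t in nhdsWithin (0:ℝ) (Set.Ioi 0), g 0 ≤ g t) : 0 ≤ g' := by
  have := h.hasDerivWithinAt (s := Set.Ioi 0)
  rw [hasDerivWithinAt_iff_tendsto_slope' (by simp)] at this
  refine ge_of_tendsto this ?_
  filter_upwards [hm, self_mem_nhdsWithin] with t h1 h2
  have h2 : 0 < t := h2
  rw [slope_def_field]
  apply div_nonneg <;> linarith

theorem annulus (n : ℕ) (hn : 1 ≤ n) (a : ℝ) (ha : (1 : ℝ) / 2 ≤ a) (lam R : ℝ)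
    (w : EuclideanSpace ℝ (Fin (n + 1)) → ℝ) (H : WH n a lam R w)
    (p : ℝ) (hp : 2 * p = n + 2 * a) (σ : ℝ) (hσ : σ ≠ 0)
    (q : EuclideanSpace ℝ (Fin (n + 1))) (hq0 : q 0 ≤ lam) (hqt : 0 < σ * q (Fin.last n))
    (b η r1 r2 : ℝ) (hb : 0 < b) (hr1 : 0 < r1) (hb1 : b < r1 ^ 2) (hη : 0 < η)
    (hR : ∀ x : EuclideanSpace ℝ (Fin (n + 1)), x 0 ≤ lam → 0 ≤ σ * x (Fin.last n) →
      r1 ≤ ‖x - q‖ → ‖x - q‖ ≤ r2 → R < ‖x‖)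
    (hin : ∀ x : EuclideanSpace ℝ (Fin (n + 1)), x 0 ≤ lam → 0 ≤ σ * x (Fin.last n) →
      ‖x - q‖ = r1 → η * bar n lam q b p ((r2 ^ 2 - b) ^ (-p)) x ≤ w x)
    (x : EuclideanSpace ℝ (Fin (n + 1))) (hx0 : x 0 ≤ lam) (hxt : 0 ≤ σ * x (Fin.last n))
    (hx1 : r1 ≤ ‖x - q‖) (hx2 : ‖x - q‖ ≤ r2) :
    η * bar n lam q b p ((r2 ^ 2 - b) ^ (-p)) x ≤ w x := by
  set d := (r2 ^ 2 - b) ^ (-p) with hd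
  set A : Set (EuclideanSpace ℝ (Fin (n + 1))) :=
    {x | x 0 ≤ lam ∧ 0 ≤ σ * x (Fin.last n) ∧ r1 ≤ ‖x - q‖ ∧ ‖x - q‖ ≤ r2} with hA
  have hbn : ∀ x : EuclideanSpace ℝ (Fin (n + 1)), r1 ≤ ‖x - q‖ → b < ‖x - q‖ ^ 2 := by
    intro x hx
    have : r1 ^ 2 ≤ ‖x - q‖ ^ 2 := by gcongr
    linarith
  have hc0 : Continuous fun x : EuclideanSpace ℝ (Fin (n + 1)) => x 0 := by fun_prop
  have hct : Continuous fun x : EuclideanSpace ℝ (Fin (n + 1)) => σ * x (Fin.last n) := by fun_prop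
  have hcq : Continuous fun x : EuclideanSpace ℝ (Fin (n + 1)) => ‖x - q‖ := by fun_prop
  have hcomp : IsCompact A := by
    refine (isCompact_closedBall q r2).of_isClosed_subset ?_ ?_
    · exact (isClosed_le hc0 continuous_const).inter ((isClosed_le continuous_const hct).inter
        ((isClosed_le continuous_const hcq).inter (isClosed_le hcq continuous_const)))
    · intro x hx
      simpa [dist_eq_norm] using hx.2.2.2
  set f := fun z => w z - η * bar n lam q b p d z with hf
  have hcont : ContinuousOn f A := by
    intro z hz
    apply ContinuousAt.continuousWithinAt
    have h1 := (H.d1 z (hR z hz.1 hz.2.1 hz.2.2.1 hz.2.2.2)).continuousAt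
    refine h1.sub (continuousAt_const.mul ?_)
    unfold bar
    refine ContinuousAt.mul (by fun_prop) (ContinuousAt.sub ?_ continuousAt_const)
    refine ContinuousAt.rpow_const (by fun_prop) (Or.inl ?_)
    have := hbn z hz.2.2.1
    linarith
  obtain ⟨z, hz, hzmin⟩ := hcomp.exists_isMinOn ⟨x, hx0, hxt, hx1, hx2⟩ hcont
  by_contra hneg
  push Not at hneg
  have hfz : f z < 0 := by
    have := hzmin (show x ∈ A from ⟨hx0, hxt, hx1, hx2⟩)
    simp only [Set.mem_ofPred_eq] at this
    have h2 : f x < 0 := by simp only [hf]; linarith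
    linarith
  obtain ⟨z0, zt, z1, z2⟩ := hz
  have zR := hR z z0 zt z1 z2
  have hw := H.nonneg z z0 zR
  have z0' : z 0 < lam := by
    refine lt_of_le_of_ne z0 fun h => ?_
    simp [hf, bar, h] at hfz
    linarith
  have z1' : r1 < ‖z - q‖ := by
    refine lt_of_le_of_ne z1 fun h => ?_
    have := hin z z0 zt h.symm
    simp only [hf] at hfz
    linarith
  have z2' : ‖z - q‖ < r2 := by
    refine lt_of_le_of_ne z2 fun h => ?_
    simp [hf, bar, h, hd] at hfz
    linarith
  rcases zt.eq_or_lt with zt | zt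
  · -- boundary
    have ht0 : z (Fin.last n) = 0 := by
      rcases mul_eq_zero.1 zt.symm with h | h
      · exact absurd h hσ
      · exact h
    have hlast : Fin.last n ≠ 0 := by
      intro h; have := congrArg Fin.val h; simp at this; omega
    have hl0 : (0 : Fin (n+1)) ≠ Fin.last n := hlast.symm
    have D1 := line_deriv z (Fin.last n) 0 (f := w) (by simpa using H.d1 z zR)
    have D2 := bar_deriv 0 (lam - z 0) (‖z - q‖^2) (z (Fin.last n) - q (Fin.last n)) b p d 0
      (by simpa using hbn z z1)
    have D : HasDerivAt (fun t : ℝ => f (z + t • EuclideanSpace.single (Fin.last n) (1:ℝ)))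
        (0 - η * bar1 0 (lam - z 0) (‖z - q‖^2) (z (Fin.last n) - q (Fin.last n)) b p d 0) 0 := by
      simp only [hf, bar_line, if_neg hlast]
      have e : pd w (Fin.last n) (z + (0:ℝ) • EuclideanSpace.single (Fin.last n) (1:ℝ)) = 0 := by
        simpa using H.neu z zR ht0
      rw [e] at D1
      exact D1.sub (D2.const_mul η)
    have Dσ := HasDerivAt.scomp (h := fun t : ℝ => t * σ) (h' := σ) (0:ℝ) (by simpa using D) (by
      simpa using (hasDerivAt_id (0:ℝ)).mul_const σ)
    have := one_sided Dσ ?_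
    · simp only [bar1, ht0] at this
      simp at this
      have hX : 0 < (‖z - q‖ ^ 2 - b) ^ (-p - 1) := Real.rpow_pos_of_pos (by linarith [hbn z z1]) _
      have hp0 : 0 < p := by
        have : (1:ℝ) ≤ n := by exact_mod_cast hn
        linarith
      have hl : 0 < lam - z 0 := by linarith
      have : 0 < (σ * q (Fin.last n)) * (η * ((lam - z 0) * (p * (‖z - q‖ ^ 2 - b) ^ (-p - 1) * 2))) := by
        positivity
      linarith
    · have tl : Filter.Tendsto (fun t : ℝ => z + (t * σ) • EuclideanSpace.single (Fin.last n) (1:ℝ)) (nhdsWithin (0:ℝ) (Set.Ioi 0)) (nhds z) := by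
        have : Continuous (fun t : ℝ => z + (t * σ) • EuclideanSpace.single (Fin.last n) (1:ℝ)) := by fun_prop
        refine Filter.Tendsto.mono_left ?_ nhdsWithin_le_nhds
        simpa using this.tendsto 0
      filter_upwards [tl.eventually (hcq.continuousAt.eventually (lt_mem_nhds z1')),
        tl.eventually (hcq.continuousAt.eventually (gt_mem_nhds z2')), self_mem_nhdsWithin] with t h1 h2 h3
      have h3 : 0 < t := h3
      simp only [Function.comp]
      simp only [zero_mul, zero_smul, add_zero]
      refine hzmin (show _ ∈ A from ⟨?_, ?_, h1.le, h2.le⟩)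
      · simp [hl0]; exact z0
      · simp [ht0]; nlinarith [sq_nonneg σ, mul_nonneg h3.le (sq_nonneg σ)]
  · -- interior
    have hzt : z (Fin.last n) ≠ 0 := by
      intro h; rw [h] at zt; simp at zt
    have hmin : IsLocalMin f z := by
      filter_upwards [hc0.continuousAt.eventually (gt_mem_nhds z0'),
        hct.continuousAt.eventually (lt_mem_nhds zt),
        hcq.continuousAt.eventually (lt_mem_nhds z1'),
        hcq.continuousAt.eventually (gt_mem_nhds z2')] with y h1 h2 h3 h4
      exact hzmin (show y ∈ A from ⟨h1.le, h2.le, h3.le, h4.le⟩)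
    refine interior_min n hn a ha lam w p hp z q ?_ (H.d2 z zR hzt) (H.sup z z0' zR hzt) z0' hq0 hzt ?_
      b d η hb (hbn z z1) hη hmin
    · filter_upwards [continuous_norm.continuousAt.eventually (lt_mem_nhds zR)] with y hy
      exact H.d1 y hy
    · have := div_pos hqt zt
      rwa [mul_div_mul_left _ _ hσ] at this

theorem coord_le {m : ℕ} (x : EuclideanSpace ℝ (Fin m)) (i : Fin m) : |x i| ≤ ‖x‖ := by
  simpa using PiLp.norm_apply_le x i

theorem local_bd (n : ℕ) (hn : 1 ≤ n) (a : ℝ) (ha : (1 : ℝ) / 2 ≤ a) (lam R : ℝ)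
    (w : EuclideanSpace ℝ (Fin (n + 1)) → ℝ) (H : WH n a lam R w)
    (p : ℝ) (hp : 2 * p = n + 2 * a) (σ : ℝ) (hσ : σ ^ 2 = 1)
    (P : EuclideanSpace ℝ (Fin (n + 1))) (hP0 : P 0 ≤ lam) (hPt : 0 ≤ σ * P (Fin.last n))
    (hPR : R + 4 < ‖P‖) :
    ∃ c > 0, ∀ᶠ x in nhds P, x 0 ≤ lam → 0 ≤ σ * x (Fin.last n) → c * (lam - x 0) ≤ w x := by
  have hlast : Fin.last n ≠ 0 := by
    intro h; have := congrArg Fin.val h; simp at this; omega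
  have hl0 : (0 : Fin (n+1)) ≠ Fin.last n := hlast.symm
  have hσ0 : σ ≠ 0 := by rintro rfl; norm_num at hσ
  have hp0 : 0 < p := by
    have : (1:ℝ) ≤ n := by exact_mod_cast hn
    linarith
  set q := (P + (-1:ℝ) • EuclideanSpace.single 0 (1:ℝ)) + σ • EuclideanSpace.single (Fin.last n) (1:ℝ) with hq
  have q0 : q 0 = P 0 - 1 := by simp [hq, hl0]; ring
  have qt : q (Fin.last n) = P (Fin.last n) + σ := by simp [hq, hlast]
  have hPq : ‖P - q‖ ^ 2 = 2 := by
    rw [norm_sub_rev, hq, line_norm, line_norm]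
    simp [hlast, hσ]; norm_num
  have hPq2 : ‖P - q‖ ≤ 2 := by nlinarith [norm_nonneg (P - q)]
  have hqR : R + 2 < ‖q‖ := by
    have := norm_sub_norm_le P q
    linarith
  have hσq : 1 ≤ σ * q (Fin.last n) := by rw [qt]; nlinarith
  have hfar : ∀ x, ‖x - q‖ ≤ 2 → R < ‖x‖ := by
    intro x hx
    have := norm_sub_norm_le q x
    rw [norm_sub_rev] at this
    linarith
  have hσabs : |σ| = 1 := by
    have : |σ| ^ 2 = 1 := by rw [sq_abs, hσ]
    nlinarith [abs_nonneg σ]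
  obtain ⟨m, hm, hmw⟩ := (isCompact_sphere q (1/2)).exists_forall_le' (f := w) (a := 0)
    (fun x hx => (H.d1 x (hfar x (by
      have : ‖x - q‖ = 1/2 := by simpa [dist_eq_norm] using hx
      linarith))).continuousAt.continuousWithinAt)
    (fun x hx => by
      have hx : ‖x - q‖ = 1/2 := by simpa [dist_eq_norm] using hx
      have h0 := coord_le (x - q) 0
      have ht := coord_le (x - q) (Fin.last n)
      rw [hx] at h0 ht
      simp only [PiLp.sub_apply] at h0 ht
      have h0 := abs_le.1 h0
      refine H.pos x (by linarith) (hfar x (by linarith)) ?_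
      intro h
      rw [h] at ht
      have : |σ * q (Fin.last n)| ≤ 1/2 := by rw [abs_mul, hσabs]; simpa using ht
      have := abs_le.1 this
      linarith)
  set B := lam - q 0 + 1 / 2 with hB
  have hBp : 0 < B := by linarith
  have hX : 0 < ((1:ℝ)/8) ^ (-p) := by positivity
  set η := m / (B * ((1:ℝ)/8) ^ (-p)) with hη
  have hηp : 0 < η := by positivity
  have hdp : 0 < ((2:ℝ) ^ 2 - 1/8) ^ (-p) := Real.rpow_pos_of_pos (by norm_num) _
  have ann := annulus n hn a ha lam R w H p hp σ hσ0 q (by linarith) (by linarith) (1/8) η (1/2) 2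
    (by norm_num) (by norm_num) (by norm_num) hηp (fun x _ _ _ h => hfar x h) (fun x hx0 hxt hx => by
      have h0 := coord_le (x - q) 0
      rw [hx] at h0
      simp only [PiLp.sub_apply] at h0
      have h0 := abs_le.1 h0
      refine le_trans ?_ (hmw x (by simpa [dist_eq_norm] using hx))
      have : bar n lam q (1/8) p ((2 ^ 2 - 1/8) ^ (-p)) x ≤ B * ((1:ℝ)/8) ^ (-p) := by
        unfold bar
        rw [hx, show ((1:ℝ)/2)^2 - 1/8 = 1/8 by norm_num]
        have h1 : 0 ≤ lam - x 0 := by linarith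
        have h2 : lam - x 0 ≤ B := by linarith
        calc _ ≤ (lam - x 0) * ((1:ℝ)/8) ^ (-p) := by
              apply mul_le_mul_of_nonneg_left _ h1
              linarith
          _ ≤ _ := by apply mul_le_mul_of_nonneg_right h2 hX.le
      calc _ ≤ η * (B * ((1:ℝ)/8) ^ (-p)) := mul_le_mul_of_nonneg_left this hηp.le
        _ = m := by rw [hη]; field_simp)
  refine ⟨η * (((3:ℝ) - 1/8) ^ (-p) - ((2:ℝ) ^ 2 - 1/8) ^ (-p)), ?_, ?_⟩
  · apply mul_pos hηp
    rw [sub_pos]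
    exact Real.rpow_lt_rpow_of_neg (by norm_num) (by norm_num) (by linarith)
  · have hcq : Continuous fun x : EuclideanSpace ℝ (Fin (n + 1)) => ‖x - q‖ ^ 2 := by fun_prop
    filter_upwards [hcq.continuousAt.eventually (lt_mem_nhds (show (1:ℝ) < ‖P - q‖ ^ 2 by rw [hPq]; norm_num)),
      hcq.continuousAt.eventually (gt_mem_nhds (show ‖P - q‖ ^ 2 < (3:ℝ) by rw [hPq]; norm_num))] with x h1 h2 hx0 hxt
    have n0 := norm_nonneg (x - q)
    refine le_trans ?_ (ann x hx0 hxt (by nlinarith) (by nlinarith))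
    unfold bar
    rw [mul_assoc, mul_comm _ (lam - x 0)]
    apply mul_le_mul_of_nonneg_left _ hηp.le
    apply mul_le_mul_of_nonneg_left _ (by linarith)
    have : ((3:ℝ) - 1/8) ^ (-p) ≤ (‖x - q‖ ^ 2 - 1/8) ^ (-p) := 
      Real.rpow_le_rpow_of_nonpos (by linarith) (by linarith) (by linarith)
    linarith

theorem key_sigma (n : ℕ) (hn : 1 ≤ n) (a : ℝ) (ha : (1 : ℝ) / 2 ≤ a) (lam R : ℝ) (hR : 0 < R)
    (w : EuclideanSpace ℝ (Fin (n + 1)) → ℝ) (H : WH n a lam R w)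
    (σ : ℝ) (hσ : σ ^ 2 = 1) :
    ∃ c > 0, ∃ S > 0, ∀ x : EuclideanSpace ℝ (Fin (n + 1)), x 0 ≤ lam → 0 ≤ σ * x (Fin.last n) → S < ‖x‖ →
      c * (lam - x 0) / ‖x‖ ^ ((n:ℝ) + 2 * a) ≤ w x := by
  have hlast : Fin.last n ≠ 0 := by
    intro h; have := congrArg Fin.val h; simp at this; omega
  have hl0 : (0 : Fin (n+1)) ≠ Fin.last n := hlast.symm
  have hσ0 : σ ≠ 0 := by rintro rfl; norm_num at hσ
  obtain ⟨p, hp⟩ : ∃ p : ℝ, 2 * p = n + 2 * a := ⟨(n + 2 * a) / 2, by ring⟩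
  have hp0 : 0 < p := by
    have : (1:ℝ) ≤ n := by exact_mod_cast hn
    linarith
  set q : EuclideanSpace ℝ (Fin (n + 1)) := lam • EuclideanSpace.single 0 (1:ℝ) + σ • EuclideanSpace.single (Fin.last n) (1:ℝ) with hq
  have q0 : q 0 = lam := by simp [hq, hl0]
  have qt : q (Fin.last n) = σ := by simp [hq, hlast]
  set r1 := R + 6 + ‖q‖ with hr1
  have nq := norm_nonneg q
  have hfar : ∀ x, r1 ≤ ‖x - q‖ → R + 4 < ‖x‖ := by
    intro x hx
    have := norm_sub_le x q
    linarith
  set K : Set (EuclideanSpace ℝ (Fin (n + 1))) := {x | x 0 ≤ lam ∧ 0 ≤ σ * x (Fin.last n) ∧ ‖x - q‖ = r1} with hK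
  have hKc : IsCompact K := by
    refine (isCompact_closedBall q r1).of_isClosed_subset ?_ ?_
    · have hc0 : Continuous fun x : EuclideanSpace ℝ (Fin (n + 1)) => x 0 := by fun_prop
      have hct : Continuous fun x : EuclideanSpace ℝ (Fin (n + 1)) => σ * x (Fin.last n) := by fun_prop
      have hcq : Continuous fun x : EuclideanSpace ℝ (Fin (n + 1)) => ‖x - q‖ := by fun_prop
      exact (isClosed_le hc0 continuous_const).inter ((isClosed_le continuous_const hct).inter
        (isClosed_eq hcq continuous_const))
    · intro x hx
      simpa [dist_eq_norm] using hx.2.2.le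
  obtain ⟨c, hc, hcK⟩ : ∃ c > 0, ∀ x ∈ K, c * (lam - x 0) ≤ w x := by
    refine hKc.induction_on (p := fun s => ∃ c > 0, ∀ x ∈ s, x ∈ K → c * (lam - x 0) ≤ w x)
      ?_ ?_ ?_ ?_ |>.imp fun c h => ⟨h.1, fun x hx => h.2 x hx hx⟩
    · exact ⟨1, one_pos, by simp⟩
    · rintro s t hst ⟨c, hc, h⟩
      exact ⟨c, hc, fun x hx => h x (hst hx)⟩
    · rintro s t ⟨c, hc, h⟩ ⟨c', hc', h'⟩
      refine ⟨min c c', lt_min hc hc', ?_⟩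
      intro x hx hxK
      have : 0 ≤ lam - x 0 := by linarith [hxK.1]
      rcases hx with hx | hx
      · exact le_trans (mul_le_mul_of_nonneg_right (min_le_left _ _) this) (h x hx hxK)
      · exact le_trans (mul_le_mul_of_nonneg_right (min_le_right _ _) this) (h' x hx hxK)
    · intro P hP
      obtain ⟨c, hc, h⟩ := local_bd n hn a ha lam R w H p hp σ hσ P hP.1 hP.2.1 (hfar P hP.2.2.ge)
      exact ⟨_, mem_nhdsWithin_of_mem_nhds h, c, hc, fun x hx hxK => hx hxK.1 hxK.2.1⟩
  have hr1' : 6 < r1 := by linarith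
  have main : ∀ x : EuclideanSpace ℝ (Fin (n + 1)), x 0 ≤ lam → 0 ≤ σ * x (Fin.last n) → r1 ≤ ‖x - q‖ →
      c * ((lam - x 0) * ((‖x - q‖ ^ 2 - 1) ^ (-p) - 0)) ≤ w x := by
    intro x hx0 hxt hx1
    have tl : Filter.Tendsto (fun r : ℝ => c * ((lam - x 0) * ((‖x - q‖ ^ 2 - 1) ^ (-p) - (r ^ 2 - 1) ^ (-p))))
        Filter.atTop (nhds (c * ((lam - x 0) * ((‖x - q‖ ^ 2 - 1) ^ (-p) - 0)))) := by
      refine Filter.Tendsto.const_mul _ (Filter.Tendsto.const_mul _ (Filter.Tendsto.const_sub _ ?_))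
      refine (tendsto_rpow_neg_atTop hp0).comp ?_
      exact Filter.tendsto_atTop_add_const_right _ _ (Filter.tendsto_pow_atTop (by norm_num))
    refine le_of_tendsto tl ?_
    filter_upwards [Filter.eventually_ge_atTop ‖x - q‖] with r hr
    refine annulus n hn a ha lam R w H p hp σ hσ0 q q0.le (by rw [qt]; nlinarith) 1 c r1 r one_pos (by linarith)
      (by nlinarith) hc (fun x _ _ h _ => by linarith [hfar x h]) (fun y hy0 hyt hy => ?_) x hx0 hxt hx1 hr
    refine le_trans ?_ (hcK y ⟨hy0, hyt, hy⟩)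
    apply mul_le_mul_of_nonneg_left _ hc.le
    unfold bar
    have h1 : 0 ≤ lam - y 0 := by linarith
    have h2 : (‖y - q‖ ^ 2 - 1) ^ (-p) ≤ 1 := by
      rw [hy]
      exact Real.rpow_le_one_of_one_le_of_nonpos (by nlinarith) (by linarith)
    have h3 : 0 ≤ (r ^ 2 - 1) ^ (-p) := Real.rpow_nonneg (by nlinarith) _
    nlinarith
  refine ⟨c * 2 ^ (-(2 * p)), by positivity, r1 + ‖q‖, by linarith, ?_⟩
  intro x hx0 hxt hx
  have hxq : r1 ≤ ‖x - q‖ := by linarith [norm_sub_norm_le x q]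
  refine le_trans ?_ (main x hx0 hxt hxq)
  have hxp : 0 < ‖x‖ := by linarith
  have e : (2:ℝ) ^ (-(2 * p)) / ‖x‖ ^ ((n:ℝ) + 2 * a) = ((2 * ‖x‖) ^ 2) ^ (-p) := by
    rw [← hp, ← Real.rpow_natCast (2 * ‖x‖) 2, ← Real.rpow_mul (by positivity), Real.mul_rpow (by norm_num) hxp.le,
      div_eq_mul_inv, ← Real.rpow_neg hxp.le]
    congr 2 <;> push_cast <;> ring
  have e2 : ((2 * ‖x‖) ^ 2) ^ (-p) ≤ (‖x - q‖ ^ 2 - 1) ^ (-p) := by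
    apply Real.rpow_le_rpow_of_nonpos
    · nlinarith
    · have h1 : ‖x - q‖ ≤ 2 * ‖x‖ := by linarith [norm_sub_le x q]
      have : ‖x - q‖ ^ 2 ≤ (2 * ‖x‖) ^ 2 := by gcongr
      linarith
    · linarith
  calc _ = c * ((lam - x 0) * ((2:ℝ) ^ (-(2 * p)) / ‖x‖ ^ ((n:ℝ) + 2 * a))) := by ring
    _ ≤ _ := by
      rw [e, sub_zero]
      apply mul_le_mul_of_nonneg_left _ hc.le
      exact mul_le_mul_of_nonneg_left e2 (by linarith)

theorem key_bd (n : ℕ) (hn : 1 ≤ n) (a : ℝ) (ha : (1 : ℝ) / 2 ≤ a) (lam R : ℝ) (hR : 0 < R)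
    (w : EuclideanSpace ℝ (Fin (n + 1)) → ℝ) (H : WH n a lam R w) :
    ∃ c > 0, ∃ S > 0, ∀ x : EuclideanSpace ℝ (Fin (n + 1)), x 0 ≤ lam → S < ‖x‖ →
      c * (lam - x 0) / ‖x‖ ^ ((n:ℝ) + 2 * a) ≤ w x := by
  obtain ⟨c, hc, S, hS, h⟩ := key_sigma n hn a ha lam R hR w H 1 (by norm_num)
  obtain ⟨c', hc', S', hS', h'⟩ := key_sigma n hn a ha lam R hR w H (-1) (by norm_num)
  refine ⟨min c c', lt_min hc hc', max S S', by positivity, ?_⟩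
  intro x hx0 hx
  have : 0 ≤ lam - x 0 := by linarith
  rcases le_total 0 (x (Fin.last n)) with ht | ht
  · refine le_trans ?_ (h x hx0 (by linarith) (lt_of_le_of_lt (le_max_left _ _) hx))
    gcongr
    exact min_le_left _ _
  · refine le_trans ?_ (h' x hx0 (by linarith) (lt_of_le_of_lt (le_max_right _ _) hx))
    gcongr
    exact min_le_right _ _

theorem refl_eq (n : ℕ) (lam : ℝ) (x : EuclideanSpace ℝ (Fin (n + 1))) :
    reflPt n lam x = x + (2 * (lam - x 0)) • EuclideanSpace.single 0 (1:ℝ) := by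
  ext i
  by_cases h : i = 0
  · subst h; simp [reflPt]; ring
  · simp [reflPt, h]

theorem refl_zero (n : ℕ) (lam : ℝ) (x : EuclideanSpace ℝ (Fin (n + 1))) :
    reflPt n lam x 0 = 2 * lam - x 0 := by simp [reflPt]

theorem refl_norm (n : ℕ) (lam : ℝ) (x : EuclideanSpace ℝ (Fin (n + 1))) :
    ‖x‖ - 2 * |lam| ≤ ‖reflPt n lam x‖ := by
  have h := line_norm x 0 0 (2 * (lam - x 0))
  rw [← refl_eq] at h
  simp only [sub_zero, PiLp.zero_apply] at h
  have h1 : lam * x 0 ≤ |lam| * ‖x‖ :=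
    le_trans (le_abs_self _) (by rw [abs_mul]; gcongr; exact coord_le x 0)
  refine (abs_le_of_sq_le_sq' ?_ (norm_nonneg _)).2
  rw [h]
  have := sq_abs lam
  nlinarith

theorem refl_smooth (n : ℕ) (lam : ℝ) : ContDiff ℝ 2 (reflPt n lam) := by
  have : reflPt n lam = fun x => x + (2 * (lam - x 0)) • EuclideanSpace.single 0 (1:ℝ) :=
    funext (refl_eq n lam)
  rw [this]
  fun_prop

theorem pd_diff {m : ℕ} {f : EuclideanSpace ℝ (Fin m) → ℝ} {x : EuclideanSpace ℝ (Fin m)}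
    (h : ContDiffAt ℝ 2 f x) (i : Fin m) : DifferentiableAt ℝ (fun z => pd f i z) x := by
  have h1 : ContDiffAt ℝ 1 (fderiv ℝ f) x := h.fderiv_right (by norm_num)
  exact (h1.differentiableAt (by norm_num)).clm_apply (differentiableAt_const _)

theorem pd_cont {m : ℕ} {f : EuclideanSpace ℝ (Fin m) → ℝ} {x : EuclideanSpace ℝ (Fin m)}
    (h : ContDiffAt ℝ 1 f x) (i : Fin m) : ContinuousAt (fun z => pd f i z) x := by
  have h1 : ContDiffAt ℝ 0 (fderiv ℝ f) x := h.fderiv_right (by norm_num)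
  exact h1.continuousAt.clm_apply continuousAt_const

theorem lineMVT {m : ℕ} {f : EuclideanSpace ℝ (Fin m) → ℝ} (x : EuclideanSpace ℝ (Fin m))
    (i : Fin m) (T B : ℝ)
    (h1 : ∀ t, |t| ≤ T → DifferentiableAt ℝ f (x + t • EuclideanSpace.single i (1:ℝ)))
    (h2 : ∀ t, |t| ≤ T → |pd f i (x + t • EuclideanSpace.single i (1:ℝ))| ≤ B)
    (t : ℝ) (ht : |t| ≤ T) :
    |f (x + t • EuclideanSpace.single i (1:ℝ)) - f x| ≤ B * |t| := by
  have := Convex.norm_image_sub_le_of_norm_hasDerivWithin_le (s := Set.Icc (-T) T) (C := B)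
    (f := fun t : ℝ => f (x + t • EuclideanSpace.single i (1:ℝ)))
    (f' := fun t => pd f i (x + t • EuclideanSpace.single i (1:ℝ))) (x := 0) (y := t)
    (fun s hs => (line_deriv x i s (h1 s (abs_le.2 hs))).hasDerivWithinAt)
    (fun s hs => by simpa using h2 s (abs_le.2 hs)) (convex_Icc _ _)
    (abs_le.1 (by simpa using le_trans (abs_nonneg t) ht)) (abs_le.1 ht)
  simpa using this

theorem line_norm_le {m : ℕ} (x : EuclideanSpace ℝ (Fin m)) (i : Fin m) (t : ℝ) :
    ‖x + t • EuclideanSpace.single i (1:ℝ)‖ ≤ ‖x‖ + |t| := by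
  refine (norm_add_le _ _).trans ?_
  simp [norm_smul]

theorem le_line_norm {m : ℕ} (x : EuclideanSpace ℝ (Fin m)) (i : Fin m) (t : ℝ) :
    ‖x‖ - |t| ≤ ‖x + t • EuclideanSpace.single i (1:ℝ)‖ := by
  have := norm_sub_le (x + t • EuclideanSpace.single i (1:ℝ)) (t • EuclideanSpace.single i (1:ℝ))
  simp [norm_smul] at this
  linarith

theorem WH_of (n : ℕ) (hn : 1 ≤ n) (a : ℝ) (lam₀ : ℝ) (R : ℝ) 
    (v : EuclideanSpace ℝ (Fin (n + 1)) → ℝ)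
    (hv2 : ContDiffOn ℝ 2 v
      {x : EuclideanSpace ℝ (Fin (n + 1)) | R < ‖x‖ ∧ x (Fin.last n) ≠ 0})
    (hv1 : ContDiffOn ℝ 1 v {x : EuclideanSpace ℝ (Fin (n + 1)) | R < ‖x‖})
    (hbdry : ∀ x : EuclideanSpace ℝ (Fin (n + 1)), R < ‖x‖ → x (Fin.last n) = 0 →
      pd v (Fin.last n) x = 0)
    (hwsuper : ∀ x : EuclideanSpace ℝ (Fin (n + 1)), x 0 < lam₀ → R < ‖x‖ →
      x (Fin.last n) ≠ 0 →
      (∑ i, pd2 (fun z => v z - v (reflPt n lam₀ z)) i i x) +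
        ((2 * a - 1) / x (Fin.last n)) *
          pd (fun z => v z - v (reflPt n lam₀ z)) (Fin.last n) x ≤ 0)
    (hwpos : ∀ x : EuclideanSpace ℝ (Fin (n + 1)), x 0 < lam₀ → R < ‖x‖ →
      x (Fin.last n) ≠ 0 → v (reflPt n lam₀ x) < v x) :
    (∀ x, R < ‖x‖ → ContDiffAt ℝ 1 v x) ∧ 
    (∀ x, R < ‖x‖ → x (Fin.last n) ≠ 0 → ContDiffAt ℝ 2 v x) ∧ 
    WH n a lam₀ (R + 2 * |lam₀|) (fun z => v z - v (reflPt n lam₀ z)) := by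
  have hlast : Fin.last n ≠ 0 := by
    intro h; have := congrArg Fin.val h; simp at this; omega
  have hl0 : (0 : Fin (n+1)) ≠ Fin.last n := hlast.symm
  have ab := abs_nonneg lam₀
  have c1 : ∀ x, R < ‖x‖ → ContDiffAt ℝ 1 v x := by
    intro x hx
    exact hv1.contDiffAt ((isOpen_lt continuous_const continuous_norm).mem_nhds hx)
  have hct : Continuous fun x : EuclideanSpace ℝ (Fin (n + 1)) => x (Fin.last n) := by fun_prop
  have c2 : ∀ x, R < ‖x‖ → x (Fin.last n) ≠ 0 → ContDiffAt ℝ 2 v x := by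
    intro x hx ht
    exact hv2.contDiffAt (((isOpen_lt continuous_const continuous_norm).inter
      (isOpen_ne_fun hct continuous_const)).mem_nhds ⟨hx, ht⟩)
  have rn : ∀ x, R + 2 * |lam₀| < ‖x‖ → R < ‖reflPt n lam₀ x‖ := by
    intro x hx
    linarith [refl_norm n lam₀ x]
  have rt : ∀ x, reflPt n lam₀ x (Fin.last n) = x (Fin.last n) := by
    intro x; simp [reflPt, hlast]
  have d1 : ∀ x, R + 2 * |lam₀| < ‖x‖ → DifferentiableAt ℝ (fun z => v z - v (reflPt n lam₀ z)) x := by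
    intro x hx
    have := (c1 x (by linarith)).sub ((c1 _ (rn x hx)).comp x ((refl_smooth n lam₀).contDiffAt.of_le (by norm_num)))
    exact this.differentiableAt (by norm_num)
  refine ⟨c1, c2, d1, ?_, ?_, ?_, ?_, ?_⟩
  · intro x hx ht i
    exact pd_diff ((c2 x (by linarith) ht).sub ((c2 _ (rn x hx) (by rwa [rt])).comp x (refl_smooth n lam₀).contDiffAt)) i
  · intro x h0 hx ht
    exact hwsuper x h0 (by linarith) ht
  · intro x hx ht
    have A := line_deriv x (Fin.last n) 0 (by simpa using d1 x hx)
    have B1 := line_deriv x (Fin.last n) 0 (f := v) (by simpa using (c1 x (by linarith)).differentiableAt (by norm_num))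
    have B2 := line_deriv (reflPt n lam₀ x) (Fin.last n) 0 (f := v) (by simpa using (c1 _ (rn x hx)).differentiableAt (by norm_num))
    have B := B1.sub B2
    have e : (fun t : ℝ => v (x + t • EuclideanSpace.single (Fin.last n) (1:ℝ)) - v (reflPt n lam₀ (x + t • EuclideanSpace.single (Fin.last n) (1:ℝ))))
      = (fun t : ℝ => v (x + t • EuclideanSpace.single (Fin.last n) (1:ℝ))) - (fun t : ℝ => v (reflPt n lam₀ x + t • EuclideanSpace.single (Fin.last n) (1:ℝ))) := by
      funext t
      simp only [Pi.sub_apply, refl_eq]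
      congr 2
      simp [hl0]
      abel
    rw [← e] at B
    have := A.unique B
    simp only [zero_smul, add_zero] at this
    rw [this, hbdry x (by linarith) ht, hbdry _ (rn x hx) (by rw [rt, ht])]
    simp
  · intro x h0 hx ht
    exact sub_pos.2 (hwpos x h0 (by linarith) ht)
  · intro x h0 hx
    rcases h0.eq_or_lt with h0 | h0
    · have : reflPt n lam₀ x = x := by rw [refl_eq, h0]; simp
      simp [this]
    by_cases ht : x (Fin.last n) = 0
    · have tl : Filter.Tendsto (fun t : ℝ => x + t • EuclideanSpace.single (Fin.last n) (1:ℝ)) (nhdsWithin (0:ℝ) (Set.Ioi 0)) (nhds x) := by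
        refine Filter.Tendsto.mono_left ?_ nhdsWithin_le_nhds
        simpa using (line_cont x (Fin.last n)).tendsto 0
      refine ge_of_tendsto ((d1 x hx).continuousAt.tendsto.comp tl) ?_
      filter_upwards [tl.eventually (continuous_norm.continuousAt.eventually (lt_mem_nhds hx)), self_mem_nhdsWithin] with t h1 h2
      have h2 : 0 < t := h2
      refine (sub_pos.2 (hwpos _ ?_ (by linarith) ?_)).le
      · simpa [hl0] using h0
      · simp [ht]; exact h2.ne'
    · exact (sub_pos.2 (hwpos x h0 (by linarith) ht)).le

set_option maxHeartbeats 1000000 in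
/-- Lemma 2.4: the continuation step of the moving plane method for the operator
`Δ + ((2a-1)/x_{n+1}) ∂_{n+1}`. -/
theorem moving_plane_continuation (n : ℕ) (hn : 1 ≤ n) (a : ℝ) (ha : (1 : ℝ) / 2 ≤ a)
    (hna : 2 < n + 2 * a) (lam₀ : ℝ) (R : ℝ) (hR : 0 < R)
    (v : EuclideanSpace ℝ (Fin (n + 1)) → ℝ)
    (hv2 : ContDiffOn ℝ 2 v
      {x : EuclideanSpace ℝ (Fin (n + 1)) | R < ‖x‖ ∧ x (Fin.last n) ≠ 0})
    (hv1 : ContDiffOn ℝ 1 v {x : EuclideanSpace ℝ (Fin (n + 1)) | R < ‖x‖})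
    (a₀ : ℝ) (ha₀ : 0 < a₀) (aa : Fin (n + 1) → ℝ) (C R₀ : ℝ) (hC : 0 < C) (hR₀ : 0 < R₀)
    (hasym : ∀ x : EuclideanSpace ℝ (Fin (n + 1)), R₀ ≤ ‖x‖ →
      |v x - a₀ / ‖x‖ ^ ((n : ℝ) + 2 * a - 2) - ∑ i, aa i * x i / ‖x‖ ^ ((n : ℝ) + 2 * a)|
        ≤ C / ‖x‖ ^ ((n : ℝ) + 2 * a))
    (hasym' : ∀ x : EuclideanSpace ℝ (Fin (n + 1)), R₀ ≤ ‖x‖ → ∀ i,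
      |pd v i x + ((n : ℝ) + 2 * a - 2) * a₀ * x i / ‖x‖ ^ ((n : ℝ) + 2 * a)|
        ≤ C / ‖x‖ ^ ((n : ℝ) + 2 * a))
    (hasym'' : ∀ x : EuclideanSpace ℝ (Fin (n + 1)), R₀ ≤ ‖x‖ → ∀ i j,
      |pd2 v i j x| ≤ C / ‖x‖ ^ ((n : ℝ) + 2 * a))
    (hbdry : ∀ x : EuclideanSpace ℝ (Fin (n + 1)), R < ‖x‖ → x (Fin.last n) = 0 →
      pd v (Fin.last n) x = 0)
    (hwsuper : ∀ x : EuclideanSpace ℝ (Fin (n + 1)), x 0 < lam₀ → R < ‖x‖ →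
      x (Fin.last n) ≠ 0 →
      (∑ i, pd2 (fun z => v z - v (reflPt n lam₀ z)) i i x) +
        ((2 * a - 1) / x (Fin.last n)) *
          pd (fun z => v z - v (reflPt n lam₀ z)) (Fin.last n) x ≤ 0)
    (hwpos : ∀ x : EuclideanSpace ℝ (Fin (n + 1)), x 0 < lam₀ → R < ‖x‖ →
      x (Fin.last n) ≠ 0 → v (reflPt n lam₀ x) < v x) :
    ∃ ε > 0, ∃ S > 0,
      (∀ x : EuclideanSpace ℝ (Fin (n + 1)), |x 0 - lam₀| < ε → S < ‖x‖ → pd v 0 x < 0) ∧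
      (∃ δ > 0, ∀ lam : ℝ, |lam - lam₀| < δ →
        ∀ x : EuclideanSpace ℝ (Fin (n + 1)), x 0 < lam → x 0 ≤ lam₀ - ε / 2 → S < ‖x‖ →
          v (reflPt n lam x) < v x) := by
  have hlast : Fin.last n ≠ 0 := by
    intro h; have := congrArg Fin.val h; simp at this; omega
  have hl0 : (0 : Fin (n+1)) ≠ Fin.last n := hlast.symm
  have ab := abs_nonneg lam₀
  obtain ⟨c1, c2, H⟩ := WH_of n hn a lam₀ R v hv2 hv1 hbdry hwsuper hwpos
  obtain ⟨c, hc, S1, hS1, hkey⟩ := key_bd n hn a ha lam₀ _ (by linarith) _ H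
  set N := (n : ℝ) + 2 * a with hN
  have hN0 : 0 < N := by linarith
  set ε := min 1 (c / (4 * (C * 8 ^ N))) with hε
  have hεp : 0 < ε := by positivity
  have hε1 : ε ≤ 1 := min_le_left _ _
  have hε2 : ε * (C * 8 ^ N) ≤ c / 4 := by
    have : ε ≤ c / (4 * (C * 8 ^ N)) := min_le_right _ _
    calc _ ≤ c / (4 * (C * 8 ^ N)) * (C * 8 ^ N) := by gcongr
      _ = c / 4 := by field_simp
  set S := 2 * (S1 + R + R₀ + 2 * |lam₀| + 2) with hS
  -- derivative on the hyperplane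
  have hplane : ∀ y : EuclideanSpace ℝ (Fin (n + 1)), y 0 = lam₀ → S1 + R + R₀ + 1 < ‖y‖ →
      pd v 0 y ≤ - (c / 2) / (2 * ‖y‖) ^ N := by
    intro y hy0 hy
    have D := line_deriv y 0 0 (f := v) (by simpa using (c1 y (by linarith)).differentiableAt (by norm_num))
    simp only [zero_smul, add_zero] at D
    have Dn := HasDerivAt.scomp (h := fun t : ℝ => -t) (h' := -1) (0:ℝ) (by simpa using D) (hasDerivAt_neg 0)
    have Dl : HasDerivAt (fun t : ℝ => t * (c / (2 * ‖y‖) ^ N)) (c / (2 * ‖y‖) ^ N) 0 := by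
      simpa using (hasDerivAt_id (0:ℝ)).mul_const (c / (2 * ‖y‖) ^ N)
    have := one_sided ((Dn.sub D).sub Dl) ?_
    · simp at this
      rw [neg_div, div_right_comm]
      linarith
    · have hlt : ∀ᶠ t in nhdsWithin (0:ℝ) (Set.Ioi 0), t < 1 :=
        nhdsWithin_le_nhds (gt_mem_nhds one_pos)
      filter_upwards [hlt, self_mem_nhdsWithin] with t ht1 ht
      have ht : 0 < t := ht
      have k := hkey (y + (-t) • EuclideanSpace.single 0 (1:ℝ)) (by simp [hy0]; exact ht.le) (by
        have := le_line_norm y 0 (-t)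
        rw [abs_neg, abs_of_pos ht] at this
        linarith)
      have er : reflPt n lam₀ (y + (-t) • EuclideanSpace.single 0 (1:ℝ)) = y + t • EuclideanSpace.single 0 (1:ℝ) := by
        rw [refl_eq, add_assoc, ← add_smul]
        congr 2
        simp [hy0]; ring
      rw [er] at k
      have h0 : (lam₀ - (y + (-t) • EuclideanSpace.single 0 (1:ℝ) : EuclideanSpace ℝ (Fin (n + 1))) 0) = t := by simp [hy0]
      rw [h0] at k
      have hle : ‖y + (-t) • EuclideanSpace.single 0 (1:ℝ)‖ ≤ 2 * ‖y‖ := by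
        have := line_norm_le y 0 (-t)
        rw [abs_neg, abs_of_pos ht] at this
        linarith
      have hpos : 0 < ‖y + (-t) • EuclideanSpace.single 0 (1:ℝ)‖ := by
        have := le_line_norm y 0 (-t)
        rw [abs_neg, abs_of_pos ht] at this
        linarith
      have hk2 : t * (c / (2 * ‖y‖) ^ N) ≤ c * t / ‖y + (-t) • EuclideanSpace.single 0 (1:ℝ)‖ ^ N := by
        rw [mul_div_assoc', mul_comm t c]
        gcongr
      simp only [Pi.sub_apply, Function.comp]
      simp only [neg_zero, zero_smul, add_zero, sub_self, zero_mul]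
      linarith
  -- off the degenerate hyperplane
  have hoff : ∀ x : EuclideanSpace ℝ (Fin (n + 1)), |x 0 - lam₀| < ε → S < ‖x‖ → x (Fin.last n) ≠ 0 →
      pd v 0 x ≤ - ((c / 4) / (4 * ‖x‖) ^ N) := by
    intro x hx0 hx ht
    set y := x + (lam₀ - x 0) • EuclideanSpace.single 0 (1:ℝ) with hy
    have hxl : |lam₀ - x 0| < ε := by rwa [abs_sub_comm]
    have y1 := line_norm_le x 0 (lam₀ - x 0)
    have y2 := le_line_norm x 0 (lam₀ - x 0)
    rw [← hy] at y1 y2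
    have hy0 : y 0 = lam₀ := by simp [hy]
    have hyt : y (Fin.last n) = x (Fin.last n) := by simp [hy, hlast]
    have P := hplane y hy0 (by linarith)
    have hxy : x = y + (x 0 - lam₀) • EuclideanSpace.single 0 (1:ℝ) := by
      rw [hy, add_assoc, ← add_smul]; simp
    have hline : ∀ t, |t| ≤ ε → ‖x‖ / 2 ≤ ‖y + t • EuclideanSpace.single 0 (1:ℝ)‖ := by
      intro t ht
      have := le_line_norm y 0 t
      linarith
    have M := lineMVT (f := fun z => pd v 0 z) y 0 ε (C / (‖x‖ / 2) ^ N)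
      (fun t ht' => pd_diff (c2 _ (by linarith [hline t ht']) (by simpa [hlast, hyt] using ht)) 0)
      (fun t ht' => by
        have h := hline t ht'
        have := hasym'' (y + t • EuclideanSpace.single 0 (1:ℝ)) (by linarith) 0 0
        refine le_trans this ?_
        have : 0 < ‖x‖ / 2 := by linarith
        gcongr)
      (x 0 - lam₀) hx0.le
    rw [← hxy] at M
    have M' := (abs_le.1 M).2
    have hxp : 0 < ‖x‖ := by linarith
    have h4 : (c / 2) / (4 * ‖x‖) ^ N ≤ (c / 2) / (2 * ‖y‖) ^ N := by
      have : 0 < ‖y‖ := by linarith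
      have h2 : 2 * ‖y‖ ≤ 4 * ‖x‖ := by linarith
      exact div_le_div_of_nonneg_left (by positivity) (by positivity) (Real.rpow_le_rpow (by positivity) h2 hN0.le)
    have h8 : C / (‖x‖ / 2) ^ N * |x 0 - lam₀| ≤ (c / 4) / (4 * ‖x‖) ^ N := by
      have e : (4 * ‖x‖) ^ N = 8 ^ N * (‖x‖ / 2) ^ N := by
        rw [← Real.mul_rpow (by norm_num) (by positivity)]
        congr 1; ring
      rw [e]
      have hX : 0 < (‖x‖ / 2) ^ N := by positivity
      have h8p : (0:ℝ) < 8 ^ N := by positivity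
      rw [div_mul_eq_mul_div, div_le_div_iff₀ hX (by positivity)]
      have : |x 0 - lam₀| * (C * 8 ^ N) ≤ c / 4 := le_trans (by gcongr) hε2
      calc _ = (|x 0 - lam₀| * (C * 8 ^ N)) * (‖x‖ / 2) ^ N := by ring
        _ ≤ _ := by gcongr
    have e5 : (c / 2) / (4 * ‖x‖) ^ N = 2 * ((c / 4) / (4 * ‖x‖) ^ N) := by ring
    rw [neg_div] at P
    linarith
  have hSp : 0 < S := by linarith
  refine ⟨ε, hεp, S, hSp, ?_, ?_⟩
  · intro x hx0 hx
    have hxp : 0 < ‖x‖ := by linarith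
    suffices h : pd v 0 x ≤ - ((c / 4) / (4 * ‖x‖) ^ N) by
      have : 0 < (c / 4) / (4 * ‖x‖) ^ N := by positivity
      linarith
    by_cases ht : x (Fin.last n) = 0
    · have tl : Filter.Tendsto (fun t : ℝ => x + t • EuclideanSpace.single (Fin.last n) (1:ℝ)) (nhdsWithin (0:ℝ) (Set.Ioi 0)) (nhds x) := by
        refine Filter.Tendsto.mono_left ?_ nhdsWithin_le_nhds
        simpa using (line_cont x (Fin.last n)).tendsto 0
      have cr : ContinuousAt (fun z : EuclideanSpace ℝ (Fin (n + 1)) => - ((c / 4) / (4 * ‖z‖) ^ N)) x := by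
        refine (ContinuousAt.div continuousAt_const ?_ (by positivity)).neg
        exact ContinuousAt.rpow_const (by fun_prop) (Or.inl (by positivity))
      refine le_of_tendsto_of_tendsto ((pd_cont (c1 x (by linarith)) 0).tendsto.comp tl) (cr.tendsto.comp tl) ?_
      filter_upwards [tl.eventually (continuous_norm.continuousAt.eventually (lt_mem_nhds hx)), self_mem_nhdsWithin] with t h1 h2
      have h2 : 0 < t := h2
      refine hoff _ ?_ h1 ?_
      · simpa [hl0] using hx0
      · simp [ht]; exact h2.ne'
    · exact hoff x hx0 hx ht
  · -- part (ii)
    set A := 2 ^ N * (((N - 2) * a₀) * (1 + (|lam₀| + 1) * (2 / ε)) + C * (2 / ε)) with hA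
    have hN2 : 0 < N - 2 := by linarith
    have hAp : 0 < A := by positivity
    refine ⟨min (1/2) (c / (4 * A)), by positivity, ?_⟩
    intro lam hlam x hxl hx0 hx
    have hl1 : |lam - lam₀| < 1/2 := lt_of_lt_of_le hlam (min_le_left _ _)
    have hl2 : |lam - lam₀| < c / (4 * A) := lt_of_lt_of_le hlam (min_le_right _ _)
    set y := reflPt n lam₀ x with hy
    have yn := refl_norm n lam₀ x
    rw [← hy] at yn
    have hxp : 0 < ‖x‖ := by linarith
    set g := lam₀ - x 0 with hg
    have hgε : ε / 2 ≤ g := by linarith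
    have hgp : 0 < g := by linarith
    have h1g : 1 ≤ (2 / ε) * g := by
      calc 1 = (2 / ε) * (ε / 2) := by field_simp
        _ ≤ _ := by gcongr
    have hy0 : y 0 = g + lam₀ := by rw [hy, refl_zero]; linarith
    have hline : ∀ t : ℝ, |t| ≤ 1 → ‖x‖ / 2 ≤ ‖y + t • EuclideanSpace.single 0 (1:ℝ)‖ := by
      intro t ht
      have := le_line_norm y 0 t
      linarith
    have M := lineMVT (f := v) y 0 1 (A * g / ‖x‖ ^ N)
      (fun t ht => (c1 _ (by linarith [hline t ht])).differentiableAt (by norm_num))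
      (fun t ht => by
        have h := hline t ht
        set z := y + t • EuclideanSpace.single 0 (1:ℝ) with hz
        have b := hasym' z (by linarith) 0
        have hz0 : |z 0| ≤ g * (1 + (|lam₀| + 1) * (2 / ε)) := by
          have e : z 0 = g + lam₀ + t := by simp [hz, hy0]
          rw [e]
          have t1 : |g + lam₀ + t| ≤ g + (|lam₀| + 1) := by
            refine (abs_add_le _ _).trans ?_
            have := abs_add_le g lam₀
            rw [abs_of_pos hgp] at this
            linarith
          have t2 : (|lam₀| + 1) * 1 ≤ (|lam₀| + 1) * ((2 / ε) * g) := by gcongr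
          nlinarith
        have hzn : 0 < ‖z‖ := by linarith
        have hX : 0 < ‖z‖ ^ N := by positivity
        have t3 : |(N - 2) * a₀ * z 0 / ‖z‖ ^ N| ≤ (N - 2) * a₀ * (g * (1 + (|lam₀| + 1) * (2 / ε))) / ‖z‖ ^ N := by
          rw [abs_div, abs_mul, abs_of_pos hX, abs_of_pos (by positivity : 0 < (N - 2) * a₀)]
          gcongr
        have t4 : C / ‖z‖ ^ N ≤ C * ((2 / ε) * g) / ‖z‖ ^ N := by
          gcongr
          nlinarith
        have t5 : |pd v 0 z| ≤ ((N - 2) * a₀ * (g * (1 + (|lam₀| + 1) * (2 / ε))) + C * ((2 / ε) * g)) / ‖z‖ ^ N := by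
          rw [add_div]
          have := abs_sub (pd v 0 z + (N - 2) * a₀ * z 0 / ‖z‖ ^ N) ((N - 2) * a₀ * z 0 / ‖z‖ ^ N)
          rw [add_sub_cancel_right] at this
          linarith
        refine t5.trans ?_
        have e : A * g / ‖x‖ ^ N = ((N - 2) * a₀ * (g * (1 + (|lam₀| + 1) * (2 / ε))) + C * ((2 / ε) * g)) / (‖x‖ / 2) ^ N := by
          rw [Real.div_rpow hxp.le (by norm_num), hA]
          field_simp
        rw [e]
        gcongr)
      (2 * (lam - lam₀)) (by rw [abs_mul]; norm_num; linarith)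
    have er : y + (2 * (lam - lam₀)) • EuclideanSpace.single 0 (1:ℝ) = reflPt n lam x := by
      rw [hy, refl_eq, refl_eq, add_assoc, ← add_smul]
      congr 2; ring
    rw [er] at M
    have k := hkey x (by linarith) (by linarith)
    simp only [← hy, ← hg] at k
    have hf : A * g / ‖x‖ ^ N * |2 * (lam - lam₀)| < c * g / ‖x‖ ^ N := by
      rw [abs_mul, abs_two, div_mul_eq_mul_div]
      have : 0 < ‖x‖ ^ N := by positivity
      gcongr ?_ / _
      have : |lam - lam₀| * (4 * A) < c := by rwa [lt_div_iff₀ (by positivity)] at hl2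
      have h1 : 0 ≤ |lam - lam₀| * A := by positivity
      have h2 : 2 * (|lam - lam₀| * A) < c := by linarith
      have h3 := mul_lt_mul_of_pos_right h2 hgp
      linarith
    have := (abs_le.1 M).2
    linarith
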